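/- arXiv:2204.11770 — 2 statements merged into one kernel-verified Lean document; each statement's English description precedes it below -/
import Mathlib

section
/- Let A be the companion matrix of f(x) = (x-1)³(x²+1) and B the companion matrix of g(x) = (x+1)(x⁴+x³+x²+x+1), and set T = B·A⁻¹ in GL(5,ℚ). Then T² = I with T ≠ I, B has order 10 and no power of B equals −I, and the hypergeometric group Γ(f,g) = ⟨A,B⟩ is the free product of the subgroup generated by T and the subgroup generated by B: the canonical group homomorphism from the abstract free product (ℤ/2ℤ) ∗ (ℤ/10ℤ) to GL(5,ℚ) sending the generator of ℤ/2ℤ to T and the generator of ℤ/10ℤ to B is injective with image Γ(f,g). -/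
open Polynomial Matrix

/-- The companion matrix of a monic degree-5 rational polynomial `p`:
the `5 × 5` matrix whose entries in position `(i+1, i)` equal `1` for
`i = 1, ..., 4`, whose last column is `(-p₀, -p₁, -p₂, -p₃, -p₄)ᵀ`
(where `pᵢ` is the coefficient of `xⁱ` in `p`), and whose remaining
entries are `0`. -/
def companionMatrix (p : ℚ[X]) : Matrix (Fin 5) (Fin 5) ℚ :=
  Matrix.of fun i j : Fin 5 =>
    if (j : ℕ) = 4 then -p.coeff i
    else if (i : ℕ) = (j : ℕ) + 1 then 1 else 0

/-- The family of types indexed by `Bool` with members `H` and `K`. -/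
def pairFamily.{u} (H K : Type u) : Bool → Type u
  | false => H
  | true => K

instance pairFamily.instGroup.{u} (H K : Type u) [hH : Group H] [hK : Group K] :
    ∀ b, Group (pairFamily H K b)
  | false => hH
  | true => hK

/-- The **ping-pong lemma** for a homomorphism out of a binary coproduct of groups. -/
theorem Monoid.Coprod.injective_of_ping_pong.{u} {G : Type*} {H K : Type u} {α : Type*} [Group G]
    [Group H] [Group K] [MulAction G α] (φ : Monoid.Coprod H K →* G) {X Y : Set α}
    (hX : X.Nonempty) (hY : Y.Nonempty) (hXY : Disjoint X Y)
    (hH : ∀ h : H, h ≠ 1 → ∀ y ∈ Y, φ (Monoid.Coprod.inl h) • y ∈ X)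
    (hK : ∀ k : K, k ≠ 1 → ∀ x ∈ X, φ (Monoid.Coprod.inr k) • x ∈ Y)
    (hcard : 3 ≤ Cardinal.mk K) : Function.Injective φ := by
  let ι : ∀ b, pairFamily H K b →* Monoid.Coprod H K
    | true => Monoid.Coprod.inr
    | false => Monoid.Coprod.inl
  let κ : Monoid.Coprod H K →* Monoid.CoprodI (pairFamily H K) := Monoid.Coprod.lift
    (Monoid.CoprodI.of (M := pairFamily H K) (i := false))
    (Monoid.CoprodI.of (M := pairFamily H K) (i := true))
  let f : ∀ b, pairFamily H K b →* G := fun b => φ.comp (ι b)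
  let S : Bool → Set α := fun b => bif b then Y else X
  have hS : Function.Injective (Monoid.CoprodI.lift f) := by
    refine Monoid.CoprodI.lift_injective_of_ping_pong f (Or.inr ⟨true, hcard⟩) S ?_ ?_ ?_
    · rintro (_ | _)
      exacts [hX, hY]
    · rintro (_ | _) (_ | _) h
      exacts [absurd rfl h, hXY, hXY.symm, absurd rfl h]
    · rintro (_ | _) (_ | _) h
      · exact absurd rfl h
      · rintro g hg _ ⟨y, hy, rfl⟩
        exact hH g hg y hy
      · rintro g hg _ ⟨x, hx, rfl⟩
        exact hK g hg x hx
      · exact absurd rfl h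
  have hικ : (Monoid.CoprodI.lift ι).comp κ = MonoidHom.id _ := by
    refine Monoid.Coprod.hom_ext (MonoidHom.ext fun x => ?_) (MonoidHom.ext fun x => ?_)
    · exact Monoid.CoprodI.lift_of (M := pairFamily H K) (i := false) ι x
    · exact Monoid.CoprodI.lift_of (M := pairFamily H K) (i := true) ι x
  have hf : Monoid.CoprodI.lift f = φ.comp (Monoid.CoprodI.lift ι) := by
    ext b x
    simp [f]
  have hκ : Function.LeftInverse (Monoid.CoprodI.lift ι) κ := DFunLike.congr_fun hικ
  rw [hf, MonoidHom.coe_comp] at hS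
  intro x y hxy
  apply hκ.injective
  apply hS
  simpa only [Function.comp_apply, hκ x, hκ y] using hxy

/-- The homomorphism from `ZMod n`, written multiplicatively, sending the generator to an element
whose `n`-th power is trivial. -/
def zmodPowersHom {G : Type*} [Group G] {n : ℕ} (g : G) (hg : g ^ n = 1) :
    Multiplicative (ZMod n) →* G :=
  AddMonoidHom.toMultiplicativeLeft
    (ZMod.lift n ⟨zmultiplesHom (Additive G) (Additive.ofMul g), by
      simp [← ofMul_pow, hg]⟩)

theorem zmodPowersHom_ofAdd_natCast {G : Type*} [Group G] {n : ℕ} (g : G) (hg : g ^ n = 1)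
    (k : ℕ) : zmodPowersHom g hg (Multiplicative.ofAdd (k : ZMod n)) = g ^ k := by
  have h := ZMod.lift_coe n ⟨zmultiplesHom (Additive G) (Additive.ofMul g), by
    simp [← ofMul_pow, hg]⟩ (k : ℤ)
  rw [Int.cast_natCast] at h
  simp only [zmodPowersHom, AddMonoidHom.coe_toMultiplicativeLeft, Function.comp_apply,
    toAdd_ofAdd, h]
  simp

theorem exists_zmodPowersHom_eq_pow {G : Type*} [Group G] {n : ℕ} [NeZero n] (g : G)
    (hg : g ^ n = 1) {x : Multiplicative (ZMod n)} (hx : x ≠ 1) :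
    ∃ k, 0 < k ∧ k < n ∧ zmodPowersHom g hg x = g ^ k := by
  refine ⟨x.toAdd.val, ?_, ZMod.val_lt _, ?_⟩
  · rw [Nat.pos_iff_ne_zero, Ne, ZMod.val_eq_zero]
    exact hx
  · rw [← zmodPowersHom_ofAdd_natCast g hg, ZMod.natCast_zmod_val, ofAdd_toAdd]

namespace HypergeometricGroup

/-- The companion matrix of `(X - 1) ^ 3 * (X ^ 2 + 1)`. -/
def matA : Matrix (Fin 5) (Fin 5) ℚ :=
  !![0, 0, 0, 0, 1; 1, 0, 0, 0, -3; 0, 1, 0, 0, 4; 0, 0, 1, 0, -4; 0, 0, 0, 1, 3]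

/-- The companion matrix of `(X + 1) * (X ^ 4 + X ^ 3 + X ^ 2 + X + 1)`. -/
def matB : Matrix (Fin 5) (Fin 5) ℚ :=
  !![0, 0, 0, 0, -1; 1, 0, 0, 0, -2; 0, 1, 0, 0, -2; 0, 0, 1, 0, -2; 0, 0, 0, 1, -2]

/-- The reflection `matB * matA⁻¹`. -/
def matT : Matrix (Fin 5) (Fin 5) ℚ :=
  !![-1, 0, 0, 0, 0; 1, 1, 0, 0, 0; -6, 0, 1, 0, 0; 2, 0, 0, 1, 0; -5, 0, 0, 0, 1]

/-- The Gram matrix of a quadratic form of signature `(4, 1)` invariant under the group. -/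
def gram : Matrix (Fin 5) (Fin 5) ℚ :=
  !![27, 5, -21, -11, -5; 5, 27, 5, -21, -11; -21, 5, 27, 5, -21; -11, -21, 5, 27, 5;
    -5, -11, -21, 5, 27]

theorem companionMatrix_eq_matA :
    companionMatrix ((X - 1) ^ 3 * (X ^ 2 + 1)) = matA := by
  have h : ((X - 1) ^ 3 * (X ^ 2 + 1) : ℚ[X]) =
      X ^ 5 + C (-3) * X ^ 4 + C 4 * X ^ 3 + C (-4) * X ^ 2 + C 3 * X + C (-1) := by
    simp only [map_neg, map_ofNat, map_one]
    ring
  rw [h]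
  ext i j
  fin_cases i <;> fin_cases j <;>
    simp [companionMatrix, matA, coeff_X, coeff_C, coeff_X_pow, -map_neg]

theorem companionMatrix_eq_matB :
    companionMatrix ((X + 1) * (X ^ 4 + X ^ 3 + X ^ 2 + X + 1)) = matB := by
  have h : ((X + 1) * (X ^ 4 + X ^ 3 + X ^ 2 + X + 1) : ℚ[X]) =
      X ^ 5 + C 2 * X ^ 4 + C 2 * X ^ 3 + C 2 * X ^ 2 + C 2 * X + C 1 := by
    simp only [map_ofNat, map_one]
    ring
  rw [h]
  ext i j
  fin_cases i <;> fin_cases j <;>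
    simp [companionMatrix, matB, coeff_X, coeff_X_pow, coeff_one, -map_neg]

theorem matT_mul_matA : matT * matA = matB := by decide +kernel

theorem matT_sq : matT ^ 2 = 1 := by decide +kernel

theorem matB_pow_ten : matB ^ 10 = 1 := by decide +kernel

theorem matB_pow_ne_one : ∀ k < 10, 0 < k → matB ^ k ≠ 1 := by decide +kernel

theorem matB_pow_ne_neg_one : ∀ k < 10, matB ^ k ≠ -1 := by decide +kernel

theorem matB_isometry : matBᵀ * gram * matB = gram := by decide +kernel

theorem matT_isometry : matTᵀ * gram * matT = gram := by decide +kernel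

/-- The bilinear form with Gram matrix `gram`. -/
def form (x y : Fin 5 → ℚ) : ℚ := x ⬝ᵥ gram *ᵥ y

/-- The time coordinate, proportional to the pairing with the `-1`-eigenvector of `matB`. -/
def time (x : Fin 5 → ℚ) : ℚ := x 0 - x 1 + x 2 - x 3 + x 4

/-- The normal vector of the hyperplane separating the two ping-pong domains. -/
def normal : Fin 5 → ℚ := ![0, -1, 1, -1, 1]

theorem form_mulVec_mulVec {M : Matrix (Fin 5) (Fin 5) ℚ} (hM : Mᵀ * gram * M = gram)
    (x y : Fin 5 → ℚ) : form (M *ᵥ x) (M *ᵥ y) = form x y := by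
  conv_rhs =>
    rw [form, ← hM, ← mulVec_mulVec, ← mulVec_mulVec, dotProduct_mulVec, vecMul_transpose]
  rfl

theorem form_comm (x y : Fin 5 → ℚ) : form x y = form y x := by
  simp only [form, gram, dotProduct, mulVec, Fin.sum_univ_five]
  simp
  ring

theorem form_self_nonneg {x : Fin 5 → ℚ} (hx : time x = 0) : 0 ≤ form x x := by
  have h4 : x 4 = -x 0 + x 1 - x 2 + x 3 := by
    rw [time] at hx
    linarith
  have h : form x x = 64 * (x 0 - x 1 / 4 + x 2 / 2 - 3 / 4 * x 3) ^ 2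
      + 28 * (x 1 - 6 / 7 * x 2 - 3 / 7 * x 3) ^ 2 + 416 / 7 * (x 2 - 15 / 26 * x 3) ^ 2
      + 40 / 13 * x 3 ^ 2 := by
    simp only [form, gram, dotProduct, mulVec, Fin.sum_univ_five]
    simp [h4]
    ring
  rw [h]
  positivity

/-- The reversed Cauchy-Schwarz inequality, in qualitative form: a timelike vector pairs strictly
negatively with every causal vector in the same half of the light cone. -/
theorem form_mul_time_neg {x y : Fin 5 → ℚ} (hx : form x x < 0) (hy : form y y ≤ 0)
    (hy0 : time y ≠ 0) : form x y * (time x * time y) < 0 := by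
  have hz : time (time y • x - time x • y) = 0 := by
    simp only [time, Pi.sub_apply, Pi.smul_apply, smul_eq_mul]
    ring
  have h := form_self_nonneg hz
  have hexp : form (time y • x - time x • y) (time y • x - time x • y) =
      time y ^ 2 * form x x + time x ^ 2 * form y y - 2 * (form x y * (time x * time y)) := by
    have hyx := form_comm y x
    simp only [form, mulVec_sub, mulVec_smul, sub_dotProduct, dotProduct_sub, smul_dotProduct,
      dotProduct_smul, smul_eq_mul] at hyx ⊢
    rw [hyx]
    ring
  have h1 : time y ^ 2 * form x x < 0 := mul_neg_of_pos_of_neg (by positivity) hx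
  have h2 : time x ^ 2 * form y y ≤ 0 := mul_nonpos_of_nonneg_of_nonpos (sq_nonneg _) hy
  linarith

theorem form_normal_matB_pow : ∀ k < 10, 0 < k →
    form (normal + (-1 : ℚ) ^ k • matB ^ (10 - k) *ᵥ normal)
      (normal + (-1 : ℚ) ^ k • matB ^ (10 - k) *ᵥ normal) ≤ 0 := by
  decide +kernel

theorem time_normal_matB_pow : ∀ k < 10, 0 < k →
    time (normal + (-1 : ℚ) ^ k • matB ^ (10 - k) *ᵥ normal) = 8 := by
  decide +kernel

theorem matB_pow_isometry (k : ℕ) : (matB ^ k)ᵀ * gram * matB ^ k = gram := by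
  induction k with
  | zero => simp
  | succ k ih =>
    calc (matB ^ (k + 1))ᵀ * gram * matB ^ (k + 1)
        = matBᵀ * ((matB ^ k)ᵀ * gram * matB ^ k) * matB := by
          rw [pow_succ, transpose_mul]
          simp only [Matrix.mul_assoc]
      _ = gram := by rw [ih, matB_isometry]

theorem time_matB_pow_mulVec (k : ℕ) (x : Fin 5 → ℚ) :
    time (matB ^ k *ᵥ x) = (-1) ^ k * time x := by
  induction k with
  | zero => simp
  | succ k ih =>
    rw [pow_succ', ← mulVec_mulVec, pow_succ', mul_assoc, ← ih]
    simp only [time, matB, mulVec, dotProduct, Fin.sum_univ_five]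
    simp
    ring

/-- The timelike vectors on the far side of the separating hyperplane. -/
def farSide : Set (Fin 5 → ℚ) := {x | form x x < 0 ∧ 0 < form x normal * time x}

/-- The timelike vectors on the side of the separating hyperplane containing the
`-1`-eigenvector of `matB`. -/
def nearSide : Set (Fin 5 → ℚ) := {x | form x x < 0 ∧ form x normal * time x < 0}

theorem matB_pow_mulVec_mem_nearSide {k : ℕ} (hk : 0 < k) (hk' : k < 10) {x : Fin 5 → ℚ}
    (hx : x ∈ farSide) : matB ^ k *ᵥ x ∈ nearSide := by
  obtain ⟨hxx, hxn⟩ := hx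
  refine ⟨(form_mulVec_mulVec (matB_pow_isometry k) x x).trans_lt hxx, ?_⟩
  have hn : matB ^ k *ᵥ (matB ^ (10 - k) *ᵥ normal) = normal := by
    rw [mulVec_mulVec, ← pow_add, Nat.add_sub_cancel' hk'.le, matB_pow_ten, one_mulVec]
  have hform : form (matB ^ k *ᵥ x) normal = form x (matB ^ (10 - k) *ᵥ normal) := by
    conv_lhs => rw [← hn]
    exact form_mulVec_mulVec (matB_pow_isometry k) _ _
  have ht := time_normal_matB_pow k hk' hk
  have h := form_mul_time_neg hxx (form_normal_matB_pow k hk' hk) (by rw [ht]; norm_num)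
  have hadd : form x (normal + (-1 : ℚ) ^ k • matB ^ (10 - k) *ᵥ normal) =
      form x normal + (-1) ^ k * form x (matB ^ (10 - k) *ᵥ normal) := by
    simp only [form, mulVec_add, mulVec_smul, dotProduct_add, dotProduct_smul, smul_eq_mul]
  rw [ht, hadd] at h
  rw [hform, time_matB_pow_mulVec]
  linarith

theorem matT_mulVec_mem_farSide {x : Fin 5 → ℚ} (hx : x ∈ nearSide) :
    matT *ᵥ x ∈ farSide := by
  obtain ⟨hxx, hxn⟩ := hx
  refine ⟨(form_mulVec_mulVec matT_isometry x x).trans_lt hxx, ?_⟩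
  have hn : matT *ᵥ normal = normal := by decide +kernel
  have hform : form (matT *ᵥ x) normal = form x normal := by
    conv_lhs => rw [← hn]
    exact form_mulVec_mulVec matT_isometry _ _
  have htime : time (matT *ᵥ x) = form x (matT *ᵥ 1) / -5 := by
    simp only [time, form, gram, matT, mulVec, dotProduct, Fin.sum_univ_five]
    simp
    ring
  have h1 : time (matT *ᵥ 1) = -15 := by decide +kernel
  have h2 : form (matT *ᵥ 1) (matT *ᵥ 1) ≤ 0 := by decide +kernel
  have h := form_mul_time_neg hxx h2 (by rw [h1]; norm_num)
  rw [h1] at h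
  rw [hform, htime]
  have hpos := mul_pos_of_neg_of_neg h hxn
  have hsq : 0 < form x normal * (form x (matT *ᵥ 1) / -5) * time x ^ 2 := by linarith
  exact pos_of_mul_pos_left hsq (sq_nonneg _)

end HypergeometricGroup

/-- `Γ(f,g) = ⟨T⟩ ∗ ⟨B⟩` for `f = ((X - 1) ^ 3 * (X ^ 2 + 1))`, `g = ((X + 1) * (X ^ 4 + X ^ 3 + X ^ 2 + X + 1))`. -/
theorem hypergeometric_free_product_case16 (A B T : GL (Fin 5) ℚ)
    (hA : (↑A : Matrix (Fin 5) (Fin 5) ℚ) = companionMatrix ((X - 1) ^ 3 * (X ^ 2 + 1)))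
    (hB : (↑B : Matrix (Fin 5) (Fin 5) ℚ) = companionMatrix ((X + 1) * (X ^ 4 + X ^ 3 + X ^ 2 + X + 1)))
    (hT : T = B * A⁻¹) :
    T ^ 2 = 1 ∧ T ≠ 1 ∧ orderOf B = 10 ∧ (∀ i : ℤ, B ^ i ≠ -1) ∧
    ∃ φ : Monoid.Coprod (Multiplicative (ZMod 2)) (Multiplicative (ZMod 10)) →* GL (Fin 5) ℚ,
      φ (Monoid.Coprod.inl (Multiplicative.ofAdd (1 : ZMod 2))) = T ∧
      φ (Monoid.Coprod.inr (Multiplicative.ofAdd (1 : ZMod 10))) = B ∧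
      Function.Injective φ ∧
      φ.range = Subgroup.closure {A, B} := by
  have hBm := hB.trans HypergeometricGroup.companionMatrix_eq_matB
  have hBpow (k : ℕ) : (↑(B ^ k) : Matrix (Fin 5) (Fin 5) ℚ) = HypergeometricGroup.matB ^ k := by
    rw [Units.val_pow_eq_pow_val, hBm]
  have hTm : (↑T : Matrix (Fin 5) (Fin 5) ℚ) = HypergeometricGroup.matT := by
    refine A.isUnit.mul_right_cancel ?_
    rw [← Units.val_mul, hT, inv_mul_cancel_right, hBm, hA,
      HypergeometricGroup.companionMatrix_eq_matA, HypergeometricGroup.matT_mul_matA]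
  have hT2 : T ^ 2 = 1 := by
    ext1
    rw [Units.val_pow_eq_pow_val, hTm, HypergeometricGroup.matT_sq, Units.val_one]
  have hT1 : T ≠ 1 := by
    rintro rfl
    exact absurd hTm (by rw [Units.val_one]; decide +kernel)
  have hB10 : B ^ 10 = 1 := by
    ext1
    rw [hBpow, HypergeometricGroup.matB_pow_ten, Units.val_one]
  have horder : orderOf B = 10 := by
    refine (orderOf_eq_iff (by norm_num)).2 ⟨hB10, fun k hk hk0 h => ?_⟩
    exact HypergeometricGroup.matB_pow_ne_one k hk hk0 (by rw [← hBpow, h, Units.val_one])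
  refine ⟨hT2, hT1, horder, fun i hi => ?_, ?_⟩
  · obtain ⟨k, hk, hki⟩ : ∃ k : ℕ, k < 10 ∧ B ^ k = B ^ i := by
      refine ⟨(i % 10).toNat, by omega, ?_⟩
      rw [← zpow_natCast, Int.toNat_of_nonneg (by omega), ← zpow_mod_orderOf B i, horder]
      rfl
    exact HypergeometricGroup.matB_pow_ne_neg_one k hk (by rw [← hBpow, hki, hi]; rfl)
  let φ := Monoid.Coprod.lift (zmodPowersHom T hT2) (zmodPowersHom B hB10)
  have hφT : φ (Monoid.Coprod.inl (Multiplicative.ofAdd (1 : ZMod 2))) = T := by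
    simpa [φ] using zmodPowersHom_ofAdd_natCast T hT2 1
  have hφB : φ (Monoid.Coprod.inr (Multiplicative.ofAdd (1 : ZMod 10))) = B := by
    simpa [φ] using zmodPowersHom_ofAdd_natCast B hB10 1
  refine ⟨φ, hφT, hφB, ?_, le_antisymm ?_ ?_⟩
  · let _ : MulAction (GL (Fin 5) ℚ) (Fin 5 → ℚ) :=
      MulAction.compHom _ (Matrix.GeneralLinearGroup.toLin (n := Fin 5) (R := ℚ)).toMonoidHom
    have h1 : (1 : Fin 5 → ℚ) ∈ HypergeometricGroup.nearSide := by
      unfold HypergeometricGroup.nearSide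
      constructor <;> decide +kernel
    refine Monoid.Coprod.injective_of_ping_pong φ
      ⟨_, HypergeometricGroup.matT_mulVec_mem_farSide h1⟩ ⟨1, h1⟩ ?_ ?_ ?_ ?_
    · exact Set.disjoint_left.2 fun x hx hx' => lt_asymm hx.2 hx'.2
    · intro g hg x hx
      obtain ⟨k, hk0, hk, hgk⟩ := exists_zmodPowersHom_eq_pow T hT2 hg
      obtain rfl : k = 1 := by omega
      change (↑(φ (Monoid.Coprod.inl g)) : Matrix (Fin 5) (Fin 5) ℚ) *ᵥ x ∈ _
      rw [Monoid.Coprod.lift_apply_inl, hgk, pow_one, hTm]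
      exact HypergeometricGroup.matT_mulVec_mem_farSide hx
    · intro g hg x hx
      obtain ⟨k, hk0, hk, hgk⟩ := exists_zmodPowersHom_eq_pow B hB10 hg
      change (↑(φ (Monoid.Coprod.inr g)) : Matrix (Fin 5) (Fin 5) ℚ) *ᵥ x ∈ _
      rw [Monoid.Coprod.lift_apply_inr, hgk, hBpow]
      exact HypergeometricGroup.matB_pow_mulVec_mem_nearSide hk0 hk hx
    · have : Cardinal.mk (Multiplicative (ZMod 10)) = 10 := Cardinal.mk_fin 10
      rw [this]
      norm_num
  · have hBmem : B ∈ Subgroup.closure {A, B} := Subgroup.subset_closure (by simp)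
    have hTmem : T ∈ Subgroup.closure {A, B} :=
      hT ▸ mul_mem hBmem (inv_mem (Subgroup.subset_closure (by simp)))
    have hle {n : ℕ} [NeZero n] (g : GL (Fin 5) ℚ) (hg : g ^ n = 1)
        (hmem : g ∈ Subgroup.closure {A, B}) :
        (zmodPowersHom g hg).range ≤ Subgroup.closure {A, B} := by
      rintro _ ⟨x, rfl⟩
      obtain rfl | hx := eq_or_ne x 1
      · simp [one_mem]
      · obtain ⟨k, -, -, hk⟩ := exists_zmodPowersHom_eq_pow g hg hx
        exact hk ▸ pow_mem hmem k
    rw [Monoid.Coprod.range_lift]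
    exact sup_le (hle T hT2 hTmem) (hle B hB10 hBmem)
  · have hBmem : B ∈ φ.range := ⟨_, hφB⟩
    rw [Subgroup.closure_le, Set.insert_subset_iff, Set.singleton_subset_iff]
    refine ⟨?_, hBmem⟩
    have hA' : A = T⁻¹ * B := by rw [hT, _root_.mul_inv_rev, inv_inv, inv_mul_cancel_right]
    rw [hA']
    exact mul_mem (inv_mem ⟨_, hφT⟩) hBmem
end

section
/- Let A be the companion matrix of f(x) = (x-1)³(x²+1) and B the companion matrix of g(x) = (x+1)(x⁴−x²+1), and set T = B·A⁻¹ in GL(5,ℚ). Then T² = I with T ≠ I, B has order 12 and no power of B equals −I, and the hypergeometric group Γ(f,g) = ⟨A,B⟩ is the free product of the subgroup generated by T and the subgroup generated by B: the canonical group homomorphism from the abstract free product (ℤ/2ℤ) ∗ (ℤ/12ℤ) to GL(5,ℚ) sending the generator of ℤ/2ℤ to T and the generator of ℤ/12ℤ to B is injective with image Γ(f,g). -/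
open Polynomial Matrix

/-- The ping-pong lemma for the free product of two groups. -/
theorem Monoid.Coprod.lift_injective_of_ping_pong {m n : ℕ} {K α : Type} [Group K] [MulAction K α]
    (f : Multiplicative (ZMod m) →* K) (g : Multiplicative (ZMod n) →* K)
    (hn : 3 ≤ Cardinal.mk (ZMod n)) (X Y : Set α) (hX : X.Nonempty) (hY : Y.Nonempty)
    (hXY : Disjoint X Y) (hf : ∀ a ≠ 1, ∀ y ∈ Y, f a • y ∈ X)
    (hg : ∀ b ≠ 1, ∀ x ∈ X, g b • x ∈ Y) :
    Function.Injective (Monoid.Coprod.lift f g) := by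
  let H : Bool → Type := fun b => Multiplicative (ZMod (cond b n m))
  let F : ∀ b, H b →* K := fun b => match b with
    | true => g
    | false => f
  let e : Monoid.Coprod (Multiplicative (ZMod m)) (Multiplicative (ZMod n)) →* Monoid.CoprodI H :=
    Monoid.Coprod.lift (Monoid.CoprodI.of (M := H) (i := false))
      (Monoid.CoprodI.of (M := H) (i := true))
  let d : Monoid.CoprodI H →* Monoid.Coprod (Multiplicative (ZMod m)) (Multiplicative (ZMod n)) :=
    Monoid.CoprodI.lift fun b => match b with
      | true => Monoid.Coprod.inr
      | false => Monoid.Coprod.inl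
  have hde : d.comp e = MonoidHom.id _ := by
    apply Monoid.Coprod.hom_ext <;> ext x <;> simp [d, e]
  have he : Function.Injective e :=
    Function.LeftInverse.injective (g := d) fun x => DFunLike.congr_fun hde x
  have hlift : Monoid.Coprod.lift f g = (Monoid.CoprodI.lift F).comp e := by
    apply Monoid.Coprod.hom_ext <;> ext x <;> simp [F, e]
  have hF : Function.Injective (Monoid.CoprodI.lift F) := by
    refine Monoid.CoprodI.lift_injective_of_ping_pong F (Or.inr ⟨true, hn⟩)
      (fun b => cond b Y X) ?_ ?_ ?_
    · rintro (_ | _)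
      exacts [hX, hY]
    · rintro (_ | _) (_ | _) h
      exacts [absurd rfl h, hXY, hXY.symm, absurd rfl h]
    · rintro (_ | _) (_ | _) h a ha
      exacts [absurd rfl h, Set.image_subset_iff.2 (hf a ha), Set.image_subset_iff.2 (hg a ha),
        absurd rfl h]
  rw [hlift]
  exact hF.comp he

/-- The homomorphism from `ℤ/n` sending the generator to an element `g` with `g ^ n = 1`. -/
def zmodPowHom {K : Type} [Group K] (n : ℕ) [NeZero n] (g : K) (hg : g ^ n = 1) :
    Multiplicative (ZMod n) →* K where
  toFun a := g ^ (Multiplicative.toAdd a).val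
  map_one' := by simp
  map_mul' a b := by
    rw [toAdd_mul, ZMod.val_add, ← pow_add]
    exact (pow_eq_pow_mod _ hg).symm

theorem zmodPowHom_apply {K : Type} [Group K] (n : ℕ) [NeZero n] (g : K) (hg : g ^ n = 1)
    (a : Multiplicative (ZMod n)) :
    zmodPowHom n g hg a = g ^ (Multiplicative.toAdd a).val := rfl

theorem zmodPowHom_range {K : Type} [Group K] (n : ℕ) [NeZero n] (hn : 1 < n) (g : K)
    (hg : g ^ n = 1) : (zmodPowHom n g hg).range = Subgroup.zpowers g := by
  apply le_antisymm
  · rintro _ ⟨a, rfl⟩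
    exact Subgroup.npow_mem_zpowers g _
  · rw [Subgroup.zpowers_le]
    refine ⟨Multiplicative.ofAdd (1 : ZMod n), ?_⟩
    have : Fact (1 < n) := ⟨hn⟩
    simp [zmodPowHom, ZMod.val_one]

namespace HypergeometricCase18

/-- The companion matrix of `(X + 1) * (X ^ 4 - X ^ 2 + 1)`, over `ℤ`. -/
def bMat : Matrix (Fin 5) (Fin 5) ℤ :=
  !![0, 0, 0, 0, -1; 1, 0, 0, 0, -1; 0, 1, 0, 0, 1; 0, 0, 1, 0, 1; 0, 0, 0, 1, -1]

/-- The reflection `T`, over `ℤ`. -/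
def tMat : Matrix (Fin 5) (Fin 5) ℤ :=
  !![-1, 0, 0, 0, 0; 2, 1, 0, 0, 0; -3, 0, 1, 0, 0; 5, 0, 0, 1, 0; -4, 0, 0, 0, 1]

/-- Gram matrix of an invariant quadratic form, of signature `(1, 4)`. -/
def gram : Matrix (Fin 5) (Fin 5) ℤ :=
  !![-61, -51, -29, -3, 35; -51, -61, -51, -29, -3; -29, -51, -61, -51, -29;
    -3, -29, -51, -61, -51; 35, -3, -29, -51, -61]

/-- The bilinear form with Gram matrix `gram`. -/
def form (x y : Fin 5 → ℤ) : ℤ := x ⬝ᵥ (gram *ᵥ y)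

/-- The vector spanning the image of `T - 1`. -/
def center : Fin 5 → ℤ := ![-2, 2, -3, 5, -4]

/-- Normal vector of a hyperplane through `center`, tangent to its image under `B`. -/
def wall : Fin 5 → ℤ := ![0, 1, -1, 1, -1]

/-- The rotated walls `(-B) ^ k • wall`. -/
def rotWall (k : ℕ) : Fin 5 → ℤ := (-bMat) ^ k *ᵥ wall

/-- The rotated images `(-B) ^ k • ((-T) • rotWall 2)`. -/
def rotFold (k : ℕ) : Fin 5 → ℤ := (-bMat) ^ k *ᵥ (-tMat *ᵥ rotWall 2)

/-- The open forward light cone. -/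
def Forward (x : Fin 5 → ℤ) : Prop := 0 < form x x ∧ 0 < form x center

/-- The half-space behind `wall`, with its part behind `rotWall 2` reflected through `center`. -/
def InTable (x : Fin 5 → ℤ) : Prop :=
  Forward x ∧ (form x (rotWall 0) ≤ 0 ∧ 0 < form x (rotWall 2) ∨
    0 ≤ form x (rotWall 0) ∧ form x (rotFold 0) ≤ 0)

theorem form_center (x : Fin 5 → ℤ) : form x center = -48 * x 0 := by
  simp [form, center, gram, dotProduct, Matrix.mulVec, Fin.sum_univ_five]
  ring

theorem form_self_nonpos {z : Fin 5 → ℤ} (hz : z 0 = 0) : form z z ≤ 0 := by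
  simp only [form, gram, dotProduct, Matrix.mulVec, Fin.sum_univ_five, hz]
  simp
  nlinarith [sq_nonneg (61 * z 1 + 51 * z 2 + 29 * z 3 + 3 * z 4),
    sq_nonneg (70 * z 2 + 102 * z 3 + 101 * z 4), sq_nonneg (3 * z 3 + 4 * z 4), sq_nonneg (z 4)]

/-- The reversed Cauchy–Schwarz inequality, in the form used here. -/
theorem Forward.form_pos {x m : Fin 5 → ℤ} (hx : Forward x) (hm : 0 ≤ form m m)
    (hmc : 0 < form m center) : 0 < form x m := by
  obtain ⟨hxx, hxc⟩ := hx
  rw [form_center] at hxc hmc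
  have hx0 : x 0 < 0 := by linarith
  have hm0 : m 0 < 0 := by linarith
  have h := form_self_nonpos (z := m 0 • x - x 0 • m) (by simp; ring)
  have hexp : form (m 0 • x - x 0 • m) (m 0 • x - x 0 • m) =
      m 0 ^ 2 * form x x - 2 * (m 0 * x 0) * form x m + x 0 ^ 2 * form m m := by
    simp [form, gram, dotProduct, Matrix.mulVec, Fin.sum_univ_five]
    ring
  have h1 : 0 < m 0 ^ 2 * form x x := mul_pos (sq_pos_of_neg hm0) hxx
  have h2 : 0 ≤ x 0 ^ 2 * form m m := by positivity
  have h3 : 0 < m 0 * x 0 := mul_pos_of_neg_of_neg hm0 hx0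
  nlinarith

theorem Forward.form_add_pos {x m n : Fin 5 → ℤ} (hx : Forward x)
    (h : 0 ≤ form (m + n) (m + n) ∧ 0 < form (m + n) center) : 0 < form x m + form x n := by
  rw [show form x m + form x n = form x (m + n) by
    simp [form, Matrix.mulVec_add, dotProduct_add]]
  exact hx.form_pos h.1 h.2

theorem form_mulVec_left {M N : Matrix (Fin 5) (Fin 5) ℤ} (h : Mᵀ * gram = gram * N)
    (x y : Fin 5 → ℤ) : form (M *ᵥ x) y = form x (N *ᵥ y) := by
  rw [form, form, Matrix.mulVec_mulVec, ← h, ← Matrix.mulVec_mulVec, Matrix.dotProduct_mulVec x,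
    Matrix.vecMul_transpose]

theorem form_rot (j : ℕ) (hj : j ≤ 12) (x y : Fin 5 → ℤ) :
    form ((-bMat) ^ (12 - j) *ᵥ x) y = form x ((-bMat) ^ j *ᵥ y) := by
  apply form_mulVec_left
  have : ∀ j ≤ 12, ((-bMat) ^ (12 - j))ᵀ * gram = gram * (-bMat) ^ j := by decide +kernel
  exact this j hj

theorem form_refl (x y : Fin 5 → ℤ) : form (-tMat *ᵥ x) y = form x (-tMat *ᵥ y) :=
  form_mulVec_left (by decide +kernel) x y

theorem neg_tMat_sq : -tMat * -tMat = 1 := by decide +kernel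

theorem wall_facts : ∀ j < 12, j ≠ 0 →
    ((j ≠ 2 ∧ j ≠ 10) → 0 ≤ form (rotWall 0 + rotWall j) (rotWall 0 + rotWall j) ∧
      0 < form (rotWall 0 + rotWall j) center) ∧
    (0 ≤ form (rotFold 0 + rotWall j) (rotFold 0 + rotWall j) ∧
      0 < form (rotFold 0 + rotWall j) center) ∧
    (0 ≤ form (rotWall 0 + rotFold j) (rotWall 0 + rotFold j) ∧
      0 < form (rotWall 0 + rotFold j) center) ∧
    (0 ≤ form (rotFold 0 + rotFold j) (rotFold 0 + rotFold j) ∧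
      0 < form (rotFold 0 + rotFold j) center) ∧
    (0 ≤ form ((-bMat) ^ j *ᵥ center) ((-bMat) ^ j *ᵥ center) ∧
      0 < form ((-bMat) ^ j *ᵥ center) center) := by
  decide +kernel

theorem rot_rotWall (j i : ℕ) : (-bMat) ^ j *ᵥ rotWall i = rotWall (j + i) := by
  rw [rotWall, rotWall, Matrix.mulVec_mulVec, pow_add]

theorem rot_rotFold (j : ℕ) : (-bMat) ^ j *ᵥ rotFold 0 = rotFold j := by
  rw [rotFold, rotFold, pow_zero, Matrix.one_mulVec]

theorem Forward.rot {z : Fin 5 → ℤ} (hz : Forward z) {j : ℕ} (hj : j < 12) (hj0 : j ≠ 0) :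
    Forward ((-bMat) ^ (12 - j) *ᵥ z) := by
  refine ⟨?_, ?_⟩
  · rw [form_rot j hj.le, Matrix.mulVec_mulVec, ← pow_add, Nat.add_sub_cancel' hj.le,
      show (-bMat) ^ 12 = 1 by decide +kernel, Matrix.one_mulVec]
    exact hz.1
  · rw [form_rot j hj.le]
    obtain ⟨-, -, -, -, h⟩ := wall_facts j hj hj0
    exact hz.form_pos h.1 h.2

theorem Forward.refl {z : Fin 5 → ℤ} (hz : Forward z) : Forward (-tMat *ᵥ z) := by
  refine ⟨?_, ?_⟩
  · rw [form_refl, Matrix.mulVec_mulVec, neg_tMat_sq, Matrix.one_mulVec]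
    exact hz.1
  · rw [form_refl, show -tMat *ᵥ center = center by decide +kernel]
    exact hz.2

theorem Forward.not_neg {z : Fin 5 → ℤ} (hz : Forward z) : ¬ Forward (-z) := by
  intro h
  have h1 := hz.2
  have h2 := h.2
  rw [form_center] at h1 h2
  simp only [Pi.neg_apply] at h2
  linarith

/-- Reflecting through `center` is the complement of `InTable`, up to boundary points. -/
theorem inTable_refl {y : Fin 5 → ℤ} (hy : Forward y)
    (h : 0 ≤ form y (rotWall 0) ∧ 0 < form y (rotFold 0) ∨
      form y (rotWall 0) ≤ 0 ∧ form y (rotWall 2) ≤ 0) : InTable (-tMat *ᵥ y) := by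
  refine ⟨hy.refl, ?_⟩
  have h0 : form (-tMat *ᵥ y) (rotWall 0) = -form y (rotWall 0) := by
    rw [form_refl, show -tMat *ᵥ rotWall 0 = -rotWall 0 by decide +kernel]
    simp [form, Matrix.mulVec_neg]
  have h2 : form (-tMat *ᵥ y) (rotWall 2) = form y (rotFold 0) := by
    rw [form_refl, rotFold, pow_zero, Matrix.one_mulVec]
  have hf : form (-tMat *ᵥ y) (rotFold 0) = form y (rotWall 2) := by
    rw [form_refl, rotFold, pow_zero, Matrix.one_mulVec, Matrix.mulVec_mulVec, neg_tMat_sq,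
      Matrix.one_mulVec]
  rw [h0, h2, hf]
  omega

theorem InTable.rot {z : Fin 5 → ℤ} (hz : InTable z) {j : ℕ} (hj : j < 12) (hj0 : j ≠ 0) :
    ¬ InTable ((-bMat) ^ (12 - j) *ᵥ z) ∧ InTable (-tMat *ᵥ ((-bMat) ^ (12 - j) *ᵥ z)) := by
  obtain ⟨hfz, hz⟩ := hz
  obtain ⟨h1, h2, h3, h4, -⟩ := wall_facts j hj hj0
  have h1 := fun h => hfz.form_add_pos (h1 h)
  have h2 := hfz.form_add_pos h2
  have h3 := hfz.form_add_pos h3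
  have h4 := hfz.form_add_pos h4
  have e0 : form ((-bMat) ^ (12 - j) *ᵥ z) (rotWall 0) = form z (rotWall j) := by
    rw [form_rot j hj.le, rot_rotWall, add_zero]
  have e2 : form ((-bMat) ^ (12 - j) *ᵥ z) (rotWall 2) = form z (rotWall (j + 2)) := by
    rw [form_rot j hj.le, rot_rotWall]
  have ef : form ((-bMat) ^ (12 - j) *ᵥ z) (rotFold 0) = form z (rotFold j) := by
    rw [form_rot j hj.le, rot_rotFold]
  have key : (form z (rotWall j) ≤ 0 → form z (rotWall (j + 2)) ≤ 0) ∧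
      0 < form z (rotFold j) := by
    rcases hz with hz | hz
    · refine ⟨fun hneg => ?_, by linarith⟩
      by_cases hj2 : j = 2
      · subst hj2
        linarith
      by_cases hj10 : j = 10
      · subst hj10
        rw [show rotWall (10 + 2) = rotWall 0 by decide +kernel]
        exact hz.1
      linarith [h1 ⟨hj2, hj10⟩]
    · exact ⟨fun hneg => by linarith, by linarith⟩
  refine ⟨fun h => ?_, inTable_refl (hfz.rot hj hj0) ?_⟩
  · have h := h.2
    rw [e0, e2, ef] at h
    omega
  · rw [e0, e2, ef]
    omega

/-- The union of the table region and its negative. -/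
def table : Set (Fin 5 → ℤ) := {x | InTable x ∨ InTable (-x)}

/-- The union of the nontrivial rotated copies of `table`. -/
def rotatedTable : Set (Fin 5 → ℤ) := {x | ∃ k < 12, k ≠ 0 ∧ ∃ z ∈ table, x = bMat ^ k *ᵥ z}

theorem neg_mem_table {x : Fin 5 → ℤ} : -x ∈ table ↔ x ∈ table := by
  simp [table, or_comm]

theorem neg_one_pow_smul_mem_table {x : Fin 5 → ℤ} (k : ℕ) :
    (-1 : ℤ) ^ k • x ∈ table ↔ x ∈ table := by
  rcases neg_one_pow_eq_or ℤ k with h | h <;> simp [h, neg_mem_table]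

theorem rot_table {z : Fin 5 → ℤ} (hz : z ∈ table) {k : ℕ} (hk : k < 12) (hk0 : k ≠ 0) :
    bMat ^ k *ᵥ z ∉ table ∧ tMat *ᵥ (bMat ^ k *ᵥ z) ∈ table := by
  wlog h : InTable z generalizing z
  · have h' := this (neg_mem_table.2 hz) (hz.resolve_left h)
    simpa only [Matrix.mulVec_neg, neg_mem_table] using h'
  obtain ⟨j, hj, hj0, rfl⟩ : ∃ j < 12, j ≠ 0 ∧ k = 12 - j := ⟨12 - k, by omega, by omega, by omega⟩
  have hr : (-bMat) ^ (12 - j) *ᵥ z = (-1 : ℤ) ^ (12 - j) • (bMat ^ (12 - j) *ᵥ z) := by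
    rw [← Matrix.smul_mulVec, ← neg_one_smul ℤ bMat, _root_.smul_pow]
  obtain ⟨h1, h2⟩ := h.rot hj hj0
  have hf := h.1.rot hj hj0
  constructor
  · rw [← neg_one_pow_smul_mem_table (12 - j), ← hr]
    rintro (h3 | h3)
    exacts [h1 h3, hf.not_neg h3.1]
  · rw [← neg_one_pow_smul_mem_table (12 - j), ← Matrix.mulVec_smul, ← hr, ← neg_mem_table,
      ← Matrix.neg_mulVec]
    exact Or.inl h2

theorem center_mem_table : center ∈ table := by
  refine Or.inl ⟨⟨?_, ?_⟩, Or.inl ⟨?_, ?_⟩⟩ <;> decide +kernel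

/-- `B` as an element of `GL(5, ℤ)`. -/
def bUnit : GL (Fin 5) ℤ := ⟨bMat, bMat ^ 11, by decide +kernel, by decide +kernel⟩

/-- `T` as an element of `GL(5, ℤ)`. -/
def tUnit : GL (Fin 5) ℤ := ⟨tMat, tMat, by decide +kernel, by decide +kernel⟩

theorem tUnit_sq : tUnit ^ 2 = 1 := by
  apply Units.ext
  rw [Units.val_pow_eq_pow_val]
  change tMat ^ 2 = 1
  decide +kernel

theorem bUnit_pow : bUnit ^ 12 = 1 := by
  apply Units.ext
  rw [Units.val_pow_eq_pow_val]
  change bMat ^ 12 = 1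
  decide +kernel

/-- The action of `GL(5, ℤ)` on column vectors. -/
instance vecAction : MulAction (GL (Fin 5) ℤ) (Fin 5 → ℤ) where
  smul g x := (g : Matrix (Fin 5) (Fin 5) ℤ) *ᵥ x
  one_smul x := Matrix.one_mulVec x
  mul_smul g h x := (Matrix.mulVec_mulVec x (g : Matrix (Fin 5) (Fin 5) ℤ) h).symm

theorem vec_smul_def (g : GL (Fin 5) ℤ) (x : Fin 5 → ℤ) :
    g • x = (g : Matrix (Fin 5) (Fin 5) ℤ) *ᵥ x := rfl

theorem lift_int_injective : Function.Injective
    (Monoid.Coprod.lift (zmodPowHom 2 tUnit tUnit_sq) (zmodPowHom 12 bUnit bUnit_pow)) := by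
  refine Monoid.Coprod.lift_injective_of_ping_pong _ _ (by simp; norm_num) table rotatedTable
    ⟨center, center_mem_table⟩ ⟨_, 1, by norm_num, one_ne_zero, center, center_mem_table, rfl⟩
    ?_ ?_ ?_
  · rw [Set.disjoint_left]
    rintro _ hx ⟨k, hk, hk0, z, hz, rfl⟩
    exact (rot_table hz hk hk0).1 hx
  · rintro a ha _ ⟨k, hk, hk0, z, hz, rfl⟩
    have ha1 : (Multiplicative.toAdd a).val = 1 := by
      revert a
      decide
    rw [zmodPowHom_apply, ha1, pow_one, vec_smul_def]
    exact (rot_table hz hk hk0).2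
  · intro b hb z hz
    refine ⟨(Multiplicative.toAdd b).val, ZMod.val_lt _, ?_, z, hz, ?_⟩
    · rw [Ne, ZMod.val_eq_zero]
      exact hb
    · rw [zmodPowHom_apply, vec_smul_def, Units.val_pow_eq_pow_val]
      rfl

/-- The inclusion of `GL(5, ℤ)` in `GL(5, ℚ)`. -/
abbrev toRat : GL (Fin 5) ℤ →* GL (Fin 5) ℚ :=
  Matrix.GeneralLinearGroup.map (Int.castRingHom ℚ)

theorem toRat_injective : Function.Injective toRat :=
  Units.map_injective (Matrix.map_injective Int.cast_injective)

theorem coe_toRat_bUnit : (toRat bUnit : Matrix (Fin 5) (Fin 5) ℚ) =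
    companionMatrix ((X + 1) * (X ^ 4 - X ^ 2 + 1)) := by
  have hp : ((X + 1) * (X ^ 4 - X ^ 2 + 1) : ℚ[X]) =
      X ^ 5 + X ^ 4 - X ^ 3 - X ^ 2 + X + 1 := by ring
  rw [hp]
  ext i j
  change ((bMat i j : ℤ) : ℚ) = _
  fin_cases i <;> fin_cases j <;>
    simp [bMat, companionMatrix, coeff_X, coeff_one, coeff_X_pow]

theorem coe_toRat_mul : (toRat (tUnit * bUnit) : Matrix (Fin 5) (Fin 5) ℚ) =
    companionMatrix ((X - 1) ^ 3 * (X ^ 2 + 1)) := by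
  have hp : ((X - 1) ^ 3 * (X ^ 2 + 1) : ℚ[X]) =
      X ^ 5 - C 3 * X ^ 4 + C 4 * X ^ 3 - C 4 * X ^ 2 + C 3 * X - 1 := by
    simp only [map_ofNat]
    ring
  have hm : tMat * bMat = !![0, 0, 0, 0, 1; 1, 0, 0, 0, -3; 0, 1, 0, 0, 4; 0, 0, 1, 0, -4;
      0, 0, 0, 1, 3] := by decide +kernel
  rw [hp]
  ext i j
  change (((tMat * bMat) i j : ℤ) : ℚ) = _
  rw [hm]
  fin_cases i <;> fin_cases j <;>
    simp [companionMatrix, coeff_X, coeff_one, coeff_X_pow]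

theorem orderOf_bUnit : orderOf bUnit = 12 := by
  rw [orderOf_eq_iff (by norm_num)]
  refine ⟨bUnit_pow, fun m hm hm0 h => ?_⟩
  have h := congrArg Units.val h
  rw [Units.val_pow_eq_pow_val] at h
  have hb : ∀ m < 12, 0 < m → bMat ^ m ≠ 1 := by decide +kernel
  exact hb m hm hm0 h

theorem bUnit_zpow_ne_neg_one (i : ℤ) : bUnit ^ i ≠ -1 := by
  intro h
  rw [← zpow_mod_orderOf, orderOf_bUnit] at h
  obtain ⟨m, hm⟩ := Int.eq_ofNat_of_zero_le (Int.emod_nonneg i (b := (12 : ℕ)) (by norm_num))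
  rw [hm, zpow_natCast] at h
  have h := congrArg Units.val h
  rw [Units.val_pow_eq_pow_val] at h
  have hb : ∀ m < 12, bMat ^ m ≠ -1 := by decide +kernel
  exact hb m (by omega) h

end HypergeometricCase18

open HypergeometricCase18
/-- `Γ(f,g) = ⟨T⟩ ∗ ⟨B⟩` for `f = ((X - 1) ^ 3 * (X ^ 2 + 1))`, `g = ((X + 1) * (X ^ 4 - X ^ 2 + 1))`. -/
theorem hypergeometric_free_product_case18 (A B T : GL (Fin 5) ℚ)
    (hA : (↑A : Matrix (Fin 5) (Fin 5) ℚ) = companionMatrix ((X - 1) ^ 3 * (X ^ 2 + 1)))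
    (hB : (↑B : Matrix (Fin 5) (Fin 5) ℚ) = companionMatrix ((X + 1) * (X ^ 4 - X ^ 2 + 1)))
    (hT : T = B * A⁻¹) :
    T ^ 2 = 1 ∧ T ≠ 1 ∧ orderOf B = 12 ∧ (∀ i : ℤ, B ^ i ≠ -1) ∧
    ∃ φ : Monoid.Coprod (Multiplicative (ZMod 2)) (Multiplicative (ZMod 12)) →* GL (Fin 5) ℚ,
      φ (Monoid.Coprod.inl (Multiplicative.ofAdd (1 : ZMod 2))) = T ∧
      φ (Monoid.Coprod.inr (Multiplicative.ofAdd (1 : ZMod 12))) = B ∧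
      Function.Injective φ ∧
      φ.range = Subgroup.closure {A, B} := by
  obtain rfl : B = toRat bUnit := Units.ext (hB.trans coe_toRat_bUnit.symm)
  obtain rfl : A = toRat (tUnit * bUnit) := Units.ext (hA.trans coe_toRat_mul.symm)
  have htinv : tUnit⁻¹ = tUnit := rfl
  obtain rfl : T = toRat tUnit := by
    rw [hT, ← map_inv, ← map_mul, _root_.mul_inv_rev, mul_inv_cancel_left, htinv]
  refine ⟨?_, ?_, ?_, ?_, toRat.comp (Monoid.Coprod.lift (zmodPowHom 2 tUnit tUnit_sq)
    (zmodPowHom 12 bUnit bUnit_pow)), ?_, ?_, ?_, ?_⟩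
  · rw [← map_pow, tUnit_sq, map_one]
  · rw [Ne, map_eq_one_iff _ toRat_injective]
    intro h
    exact absurd (congrArg Units.val h) (show tMat ≠ 1 by decide +kernel)
  · rw [orderOf_injective _ toRat_injective, orderOf_bUnit]
  · intro i h
    rw [← map_zpow] at h
    refine bUnit_zpow_ne_neg_one i (toRat_injective (h.trans ?_))
    ext i j
    simp [Matrix.one_apply]
  · simp [zmodPowHom, ZMod.val_one]
  · simp [zmodPowHom, ZMod.val_one'']
  · exact toRat_injective.comp lift_int_injective
  · rw [MonoidHom.range_comp, Monoid.Coprod.range_lift, zmodPowHom_range 2 (by norm_num),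
      zmodPowHom_range 12 (by norm_num), Subgroup.map_sup, MonoidHom.map_zpowers,
      MonoidHom.map_zpowers]
    apply le_antisymm
    · have hb : toRat bUnit ∈ Subgroup.closure {toRat (tUnit * bUnit), toRat bUnit} :=
        Subgroup.subset_closure (by simp)
      have ha : toRat (tUnit * bUnit) ∈ Subgroup.closure {toRat (tUnit * bUnit), toRat bUnit} :=
        Subgroup.subset_closure (by simp)
      refine sup_le (Subgroup.zpowers_le.2 ?_) (Subgroup.zpowers_le.2 hb)
      have h := mul_mem ha (inv_mem hb)
      rwa [← map_inv, ← map_mul, mul_inv_cancel_right] at h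
    · have ht : toRat tUnit ∈ Subgroup.zpowers (toRat tUnit) ⊔ Subgroup.zpowers (toRat bUnit) :=
        Subgroup.mem_sup_left (Subgroup.mem_zpowers _)
      have hb : toRat bUnit ∈ Subgroup.zpowers (toRat tUnit) ⊔ Subgroup.zpowers (toRat bUnit) :=
        Subgroup.mem_sup_right (Subgroup.mem_zpowers _)
      rw [Subgroup.closure_le]
      rintro _ (rfl | rfl)
      · rw [map_mul]
        exact mul_mem ht hb
      · exact hb
end
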